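/- Consider the Bayesian linear Gaussian model: let θ = (α, η) be an ℝ^{m₁+m₂}-valued random vector with law N(0, A) where A = bdiag(Σ_α, Σ_η) with Σ_α (size m₁ × m₁) and Σ_η (size m₂ × m₂) positive definite; let the noise ε = (ε_X, ε_Y) ~ N(0, bdiag(D_X, σ_Y² I_{N₂})) be independent of θ, with D_X = bdiag(σ_{X₁}² I_{n¹}, …, σ_{X_K}² I_{n^K}) and all variances positive. Let C_X be an N₁ × m₁ matrix, C_{Y,α} an N₂ × m₁ matrix, C_{Y,η} an N₂ × m₂ matrix, and μ_X ∈ ℝ^{N₁}, μ_Y ∈ ℝ^{N₂} fixed mean vectors. Define the observed data X = μ_X + C_X α + ε_X and Y = μ_Y + C_{Y,α} α + C_{Y,η} η + ε_Y. Write D_{X,Y} = bdiag(D_X^{1/2}, σ_Y I_{N₂}) and U = D_{X,Y}^{-1} · [[C_X, 0], [C_{Y,α}, C_{Y,η}]]. Then a regular conditional distribution of θ given (X, Y) satisfies: for almost every observed value (x, y) (with respect to the law of (X,Y)), the conditional law of θ is N( (A^{-1} + UᵀU)^{-1} Uᵀ D_{X,Y}^{-1} (x − μ_X, y − μ_Y),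 (A^{-1} + UᵀU)^{-1} ). -/

import Mathlib

open Matrix MeasureTheory ProbabilityTheory

/-- The multivariate Gaussian distribution `N(μ, S)` on `ι → ℝ`, defined via its
Lebesgue density `x ↦ exp(-(x-μ)ᵀ S⁻¹ (x-μ)/2) / √((2π)^card ι · det S)`. -/
noncomputable def mvGaussian {ι : Type*} [Fintype ι] [DecidableEq ι]
    (μ : ι → ℝ) (S : Matrix ι ι ℝ) : Measure (ι → ℝ) :=
  volume.withDensity fun x =>
    ENNReal.ofReal (Real.exp (-(1 / 2) * ((x - μ) ⬝ᵥ (S⁻¹ *ᵥ (x - μ)))) /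
      Real.sqrt ((2 * Real.pi) ^ (Fintype.card ι) * S.det))


theorem joint_aux {Ω E F : Type*} [MeasurableSpace Ω] {P : Measure Ω} [IsProbabilityMeasure P]
    [MeasureSpace E] [MeasureSpace F] [AddCommGroup F] [MeasurableAdd₂ F] [MeasurableNeg F]
    [SigmaFinite (volume : Measure E)] [SigmaFinite (volume : Measure F)]
    [(volume : Measure F).IsAddRightInvariant]
    (θ : Ω → E) (ε : Ω → F) (hθ : Measurable θ) (hε : Measurable ε) (c : E → F) (hc : Measurable c)
    (p : E → ENNReal) (g q : F → ENNReal) (k : F → E → ENNReal)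
    (hp : Measurable p) (hg : Measurable g) (hq : Measurable q)
    (hk : Measurable (Function.uncurry k))
    (hind : P.map (fun ω => (θ ω, ε ω)) = (volume.withDensity p).prod (volume.withDensity g))
    (hfac : ∀ w t, p t * g (w - c t) = q w * k w t)
    (hone : ∀ w, ∫⁻ t, k w t = 1) :
    ∃ κ : Kernel F E, IsMarkovKernel κ ∧
      P.map (fun ω => (c (θ ω) + ε ω, θ ω)) = (P.map fun ω => c (θ ω) + ε ω) ⊗ₘ κ ∧
      ∀ w, κ w = volume.withDensity (k w) := by
  let κ : Kernel F E := Kernel.withDensity (Kernel.const F volume) k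
  have hκ : ∀ w, κ w = volume.withDensity (k w) := fun w => by
    simp [κ, Kernel.withDensity_apply _ hk]
  have hM : IsMarkovKernel κ := ⟨fun w => ⟨by
    rw [hκ, withDensity_apply _ MeasurableSet.univ, Measure.restrict_univ, hone]⟩⟩
  have hG : Measurable (fun z : E × F => (c z.1 + z.2, z.1)) := by fun_prop
  have hkw : ∀ w, Measurable (k w) := fun w => hk.comp measurable_prodMk_left
  have key : P.map (fun ω => (c (θ ω) + ε ω, θ ω)) = (volume.withDensity q) ⊗ₘ κ := by
    have h1 : P.map (fun ω => (c (θ ω) + ε ω, θ ω)) =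
        (P.map (fun ω => (θ ω, ε ω))).map (fun z : E × F => (c z.1 + z.2, z.1)) := by
      rw [Measure.map_map hG (by fun_prop)]; rfl
    rw [h1, hind, prod_withDensity hp hg]
    ext s hs
    let f : F × E → ENNReal := s.indicator 1
    have hf : Measurable f := measurable_one.indicator hs
    rw [← lintegral_indicator_one hs, ← lintegral_indicator_one hs]
    change ∫⁻ a, f a ∂_ = ∫⁻ a, f a ∂_
    rw [lintegral_map hf hG, lintegral_withDensity_eq_lintegral_mul _ (by fun_prop) (by fun_prop),
      lintegral_prod _ (by fun_prop), Measure.lintegral_compProd hf,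
      lintegral_withDensity_eq_lintegral_mul _ hq (Measurable.lintegral_kernel_prod_right' hf)]
    simp only [Pi.mul_apply]
    calc _ = ∫⁻ t : E, ∫⁻ w : F, p t * g (w - c t) * f (w, t) := by
          refine lintegral_congr fun t => ?_
          rw [← lintegral_sub_right_eq_self _ (c t)]
          simp
      _ = ∫⁻ w : F, ∫⁻ t : E, p t * g (w - c t) * f (w, t) := by
          refine lintegral_lintegral_swap ?_
          have : Measurable (fun z : E × F => p z.1 * g (z.2 - c z.1) * f (z.2, z.1)) := by fun_prop
          exact this.aemeasurable
      _ = _ := by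
          refine lintegral_congr fun w => ?_
          have hfw : Measurable fun t => f (w, t) := by fun_prop
          rw [hκ, lintegral_withDensity_eq_lintegral_mul _ (hkw w) hfw,
            ← lintegral_const_mul _ ((hkw w).mul hfw)]
          refine lintegral_congr fun t => ?_
          simp [hfac, mul_assoc]
  refine ⟨κ, hM, ?_, hκ⟩
  have h2 : (P.map fun ω => c (θ ω) + ε ω) = volume.withDensity q := by
    have : (P.map fun ω => c (θ ω) + ε ω) = (P.map (fun ω => (c (θ ω) + ε ω, θ ω))).fst := by
      rw [Measure.fst_map_prodMk (by fun_prop)]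
    rw [this, key, Measure.fst_compProd]
  rw [h2, key]

theorem lint_std (ι : Type*) [Fintype ι] :
    ∫⁻ x : ι → ℝ, ENNReal.ofReal (Real.exp (-(1/2) * (x ⬝ᵥ x)))
      = ENNReal.ofReal (Real.sqrt ((2 * Real.pi) ^ Fintype.card ι)) := by
  have h : ∀ x : ι → ℝ, Real.exp (-(1/2) * (x ⬝ᵥ x)) = ∏ i, Real.exp (-(1/2) * (x i)^2) := by
    intro x
    rw [← Real.exp_sum, dotProduct, Finset.mul_sum]
    simp [sq]
  simp_rw [h]
  rw [← ofReal_integral_eq_lintegral_ofReal]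
  · rw [integral_fintype_prod_volume_eq_pow (fun y : ℝ => Real.exp (-(1/2) * y^2)), integral_gaussian]
    congr 1
    rw [show Real.pi / (1/2) = 2 * Real.pi by ring]
    symm
    rw [Real.sqrt_eq_iff_mul_self_eq (by positivity) (by positivity), ← mul_pow,
      Real.mul_self_sqrt (by positivity)]
  · exact Integrable.fintype_prod (fun i => integrable_exp_neg_mul_sq (by norm_num))
  · exact Filter.Eventually.of_forall fun x => by positivity

theorem lint_gauss {ι : Type*} [Fintype ι] [DecidableEq ι] (μ : ι → ℝ) (S : Matrix ι ι ℝ)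
    (hS : S.PosDef) :
    ∫⁻ x, ENNReal.ofReal (Real.exp (-(1 / 2) * ((x - μ) ⬝ᵥ (S⁻¹ *ᵥ (x - μ)))) /
      Real.sqrt ((2 * Real.pi) ^ (Fintype.card ι) * S.det)) = 1 := by
  obtain ⟨B, hB⟩ : ∃ B : Matrix ι ι ℝ, S⁻¹ = Bᵀ * B := by
    open scoped MatrixOrder in
    obtain ⟨B, hB⟩ := CStarAlgebra.nonneg_iff_eq_star_mul_self.mp hS.inv.posSemidef.nonneg
    exact ⟨B, by simpa [star_eq_conjTranspose] using hB⟩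
  have hSd : 0 < S.det := hS.det_pos
  have hdet : S.det⁻¹ = B.det * B.det := by
    have := congrArg det hB
    rwa [det_nonsing_inv, Ring.inverse_eq_inv', det_mul, det_transpose] at this
  have hB0 : B.det ≠ 0 := by
    intro h; rw [h] at hdet; simp at hdet; exact hSd.ne' hdet
  have hq : ∀ x : ι → ℝ, x ⬝ᵥ (S⁻¹ *ᵥ x) = (B *ᵥ x) ⬝ᵥ (B *ᵥ x) := by
    intro x
    rw [hB, ← mulVec_mulVec, dotProduct_mulVec, vecMul_transpose]
  rw [lintegral_sub_right_eq_self (fun x => ENNReal.ofReal (Real.exp (-(1 / 2) * (x ⬝ᵥ (S⁻¹ *ᵥ x))) /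
      Real.sqrt ((2 * Real.pi) ^ (Fintype.card ι) * S.det))) μ]
  simp_rw [hq, div_eq_mul_inv]
  have hpos : 0 < Real.sqrt ((2 * Real.pi) ^ (Fintype.card ι) * S.det) := by positivity
  simp_rw [fun a : ι → ℝ => ENNReal.ofReal_mul (q := (Real.sqrt ((2 * Real.pi) ^ (Fintype.card ι) * S.det))⁻¹) (Real.exp_pos (-(1 * 2⁻¹) * ((B *ᵥ a) ⬝ᵥ (B *ᵥ a)))).le]
  have hm0 : Measurable fun x : ι → ℝ => ENNReal.ofReal (Real.exp (-(1/2) * (x ⬝ᵥ x))) := by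
    unfold dotProduct; fun_prop
  have hBm : Measurable (toLin' B : (ι → ℝ) → (ι → ℝ)) :=
    (LinearMap.continuous_of_finiteDimensional _).measurable
  have h3 := lintegral_map (μ := volume) hm0 hBm
  rw [Real.map_matrix_volume_pi_eq_smul_volume_pi hB0, lintegral_smul_measure, lint_std] at h3
  rw [lintegral_mul_const _ (by simpa [div_eq_mul_inv, Function.comp_def] using hm0.comp hBm)]
  have h4 : ∫⁻ a : ι → ℝ, ENNReal.ofReal (Real.exp (-(1 * 2⁻¹) * ((B *ᵥ a) ⬝ᵥ (B *ᵥ a)))) =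
    ∫⁻ a : ι → ℝ, ENNReal.ofReal (Real.exp (-(1/2) * (toLin' B a ⬝ᵥ toLin' B a))) := by
    simp [toLin'_apply]
  rw [h4, ← h3, smul_eq_mul, ← ENNReal.ofReal_mul (by positivity), ← ENNReal.ofReal_mul (by positivity),
    ← ENNReal.ofReal_one]
  congr 1
  have h5 : |B.det⁻¹| = Real.sqrt S.det := by
    symm
    rw [Real.sqrt_eq_iff_mul_self_eq hSd.le (abs_nonneg _), abs_mul_abs_self, ← mul_inv, ← hdet, inv_inv]
  rw [h5, ← Real.sqrt_mul hSd.le, mul_comm S.det]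
  exact mul_inv_cancel₀ hpos.ne'

theorem pd_blocks {m n : Type*} [Fintype m] [Fintype n]
    {A : Matrix m m ℝ} {B : Matrix n n ℝ} (hA : A.PosDef) (hB : B.PosDef) :
    (fromBlocks A 0 0 B).PosDef := by
  refine PosDef.of_dotProduct_mulVec_pos ?_ ?_
  · exact hA.1.fromBlocks (by simp) hB.1
  · intro x hx
    obtain ⟨u, v, rfl⟩ : ∃ u v, x = Sum.elim u v := ⟨x ∘ Sum.inl, x ∘ Sum.inr, by simp⟩
    have h1 := hA.posSemidef.dotProduct_mulVec_nonneg u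
    have h2 := hB.posSemidef.dotProduct_mulVec_nonneg v
    simp only [star_trivial, fromBlocks_mulVec, Sum.elim_comp_inl, Sum.elim_comp_inr,
      zero_mulVec, add_zero, zero_add, sumElim_dotProduct_sumElim] at *
    by_cases hu : u = 0
    · have hv : v ≠ 0 := by
        rintro rfl; apply hx; subst hu; ext (i | i) <;> rfl
      have := hB.dotProduct_mulVec_pos hv
      simp only [star_trivial] at this
      linarith
    · have := hA.dotProduct_mulVec_pos hu
      simp only [star_trivial] at this
      linarith

theorem quad_id {m n : Type*} [Fintype m] [Fintype n] [DecidableEq m]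
    (Ai : Matrix m m ℝ) (U : Matrix n m ℝ) (Q : Matrix m m ℝ) (hQ : Q = Ai + Uᵀ * U)
    (hs : Qᵀ = Q) (y : n → ℝ) (M t : m → ℝ) (hM : Q *ᵥ M = Uᵀ *ᵥ y) :
    t ⬝ᵥ (Ai *ᵥ t) + (y - U *ᵥ t) ⬝ᵥ (y - U *ᵥ t)
      = y ⬝ᵥ y - M ⬝ᵥ (Q *ᵥ M) + (t - M) ⬝ᵥ (Q *ᵥ (t - M)) := by
  have h1 : M ⬝ᵥ (Q *ᵥ t) = t ⬝ᵥ (Uᵀ *ᵥ y) := by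
    rw [← hM, dotProduct_mulVec, ← mulVec_transpose, hs, dotProduct_comm]
  have h2 : t ⬝ᵥ (Uᵀ *ᵥ y) = (U *ᵥ t) ⬝ᵥ y := by
    rw [dotProduct_mulVec, vecMul_transpose]
  have h3 : t ⬝ᵥ (Q *ᵥ t) = t ⬝ᵥ (Ai *ᵥ t) + (U *ᵥ t) ⬝ᵥ (U *ᵥ t) := by
    rw [hQ, add_mulVec, dotProduct_add, ← mulVec_mulVec, dotProduct_mulVec t Uᵀ, vecMul_transpose]
  simp only [mulVec_sub, dotProduct_sub, sub_dotProduct, h3, h1, hM]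
  rw [dotProduct_comm y (U *ᵥ t), h2]
  ring

theorem posterior_general {Ω m n : Type*} [MeasurableSpace Ω] (P : Measure Ω)
    [IsProbabilityMeasure P] [Fintype m] [Fintype n] [DecidableEq m] [DecidableEq n]
    (A : Matrix m m ℝ) (hA : A.PosDef) (d : n → ℝ) (hd : ∀ i, 0 < d i)
    (C : Matrix n m ℝ) (b : n → ℝ)
    (θ : Ω → m → ℝ) (ε : Ω → n → ℝ) (hθm : Measurable θ) (hεm : Measurable ε)
    (hlawθ : P.map θ = mvGaussian 0 A)
    (hlawε : P.map ε = mvGaussian 0 (diagonal fun i => d i ^ 2))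
    (hindep : P.map (fun ω => (θ ω, ε ω)) = (P.map θ).prod (P.map ε)) :
    ∃ κ : Kernel (n → ℝ) (m → ℝ), IsMarkovKernel κ
      ∧ P.map (fun ω => (b + C *ᵥ θ ω + ε ω, θ ω))
        = (P.map fun ω => b + C *ᵥ θ ω + ε ω) ⊗ₘ κ
      ∧ ∀ w, κ w = mvGaussian
          ((A⁻¹ + ((diagonal d)⁻¹ * C)ᵀ * ((diagonal d)⁻¹ * C))⁻¹ *ᵥ
            (((diagonal d)⁻¹ * C)ᵀ *ᵥ ((diagonal d)⁻¹ *ᵥ (w - b))))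
          (A⁻¹ + ((diagonal d)⁻¹ * C)ᵀ * ((diagonal d)⁻¹ * C))⁻¹ := by
  set D := (diagonal d)⁻¹ with hD
  set U := D * C with hU
  set Q := A⁻¹ + Uᵀ * U with hQ
  have hQpd : Q.PosDef := hA.inv.add_posSemidef (by
    simpa using posSemidef_conjTranspose_mul_self U)
  have hQs : Qᵀ = Q := by simpa using hQpd.isHermitian.eq
  have hQu : IsUnit Q.det := (isUnit_iff_isUnit_det Q).mp hQpd.isUnit
  have hDi : D = diagonal fun i => (d i)⁻¹ := by
    rw [hD]
    refine inv_eq_right_inv ?_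
    rw [diagonal_mul_diagonal, ← diagonal_one]
    congr 1; ext i; exact mul_inv_cancel₀ (hd i).ne'
  have hRi : (diagonal fun i => d i ^ 2)⁻¹ = D * D := by
    refine inv_eq_right_inv ?_
    rw [hDi, diagonal_mul_diagonal, diagonal_mul_diagonal, ← diagonal_one]
    congr 1; ext i; have := (hd i).ne'; field_simp
  have hRq : ∀ r : n → ℝ, r ⬝ᵥ ((diagonal fun i => d i ^ 2)⁻¹ *ᵥ r) = (D *ᵥ r) ⬝ᵥ (D *ᵥ r) := by
    intro r
    have hDt : Dᵀ = D := by rw [hDi, diagonal_transpose]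
    conv_lhs => rw [hRi, ← mulVec_mulVec, dotProduct_mulVec, ← mulVec_transpose, hDt]
  have hRd : 0 < (diagonal fun i => d i ^ 2).det := by
    rw [det_diagonal]; exact Finset.prod_pos fun i _ => pow_pos (hd i) 2
  have hAd : 0 < A.det := hA.det_pos
  have hVd : 0 < Q⁻¹.det := hQpd.inv.det_pos
  let cA : ℝ := Real.sqrt ((2 * Real.pi) ^ (Fintype.card m) * A.det)
  let cR : ℝ := Real.sqrt ((2 * Real.pi) ^ (Fintype.card n) * (diagonal fun i => d i ^ 2).det)
  let cV : ℝ := Real.sqrt ((2 * Real.pi) ^ (Fintype.card m) * Q⁻¹.det)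
  have hcA : 0 < cA := by positivity
  have hcR : 0 < cR := by positivity
  have hcV : 0 < cV := by positivity
  let M : (n → ℝ) → m → ℝ := fun w => Q⁻¹ *ᵥ (Uᵀ *ᵥ (D *ᵥ (w - b)))
  have hMm : Continuous M := by
    fun_prop
  have hQM : ∀ w, Q *ᵥ M w = Uᵀ *ᵥ (D *ᵥ (w - b)) := by
    intro w
    simp only [M]
    rw [mulVec_mulVec, mul_nonsing_inv _ hQu, one_mulVec]
  have hcm : Measurable fun t : m → ℝ => b + C *ᵥ t := by
    apply Continuous.measurable; fun_prop
  obtain ⟨κ, h1, h2, h3⟩ := joint_aux (P := P) θ ε hθm hεm (fun t => b + C *ᵥ t) hcm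
    (fun x => ENNReal.ofReal (Real.exp (-(1 / 2) * ((x - 0) ⬝ᵥ (A⁻¹ *ᵥ (x - 0)))) / cA))
    (fun x => ENNReal.ofReal (Real.exp (-(1 / 2) *
      ((x - 0) ⬝ᵥ ((diagonal fun i => d i ^ 2)⁻¹ *ᵥ (x - 0)))) / cR))
    (fun w => ENNReal.ofReal (Real.exp (-(1 / 2) * ((D *ᵥ (w - b)) ⬝ᵥ (D *ᵥ (w - b))
      - M w ⬝ᵥ (Q *ᵥ M w))) * cV / (cA * cR)))
    (fun w x => ENNReal.ofReal (Real.exp (-(1 / 2) * ((x - M w) ⬝ᵥ (Q⁻¹⁻¹ *ᵥ (x - M w)))) / cV))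
    (by apply Measurable.ennreal_ofReal; apply Continuous.measurable; fun_prop)
    (by apply Measurable.ennreal_ofReal; apply Continuous.measurable; fun_prop)
    (by apply Measurable.ennreal_ofReal; apply Continuous.measurable; fun_prop)
    (by apply Measurable.ennreal_ofReal; apply Continuous.measurable; fun_prop)
    (by rw [hindep, hlawθ, hlawε]; rfl)
    (by
      intro w t
      have hid := quad_id A⁻¹ U Q hQ hQs (D *ᵥ (w - b)) (M w) t (hQM w)
      have hv : D *ᵥ (w - (b + C *ᵥ t)) = D *ᵥ (w - b) - U *ᵥ t := by
        rw [← sub_sub, mulVec_sub, hU, mulVec_mulVec]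
      rw [← ENNReal.ofReal_mul (by positivity), ← ENNReal.ofReal_mul (by positivity)]
      congr 1
      simp only [sub_zero]
      rw [hRq, hv, nonsing_inv_nonsing_inv _ hQu, div_mul_div_comm, ← Real.exp_add, ← mul_add, hid,
        mul_add, Real.exp_add]
      field_simp)
    (fun w => lint_gauss (M w) Q⁻¹ hQpd.inv)
  exact ⟨κ, h1, h2, h3⟩

/-- Posterior of the scores in the Bayesian linear Gaussian model: with prior
`θ = (α, η) ~ N(0, A)`, `A = bdiag(Σ_α, Σ_η)` positive definite blocks, independent noise
`ε = (ε_X, ε_Y) ~ N(0, bdiag(D_X, σ_Y² I))`, and data `(X, Y) = μ + C θ + ε` with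
`C = [[C_X, 0], [C_{Y,α}, C_{Y,η}]]`, a regular conditional distribution of `θ` given
`(X, Y)` is a.e. `N((A⁻¹ + UᵀU)⁻¹ Uᵀ D_{X,Y}⁻¹ (w − μ), (A⁻¹ + UᵀU)⁻¹)` where
`U = D_{X,Y}⁻¹ C` and `D_{X,Y} = bdiag(D_X^{1/2}, σ_Y I)`. -/
theorem posterior_scores_gaussian
    {Ω : Type*} [MeasurableSpace Ω] (P : Measure Ω) [IsProbabilityMeasure P]
    (K m₁ m₂ N₂ : ℕ) (n : Fin K → ℕ)
    (Sα : Matrix (Fin m₁) (Fin m₁) ℝ) (hSa : Sα.PosDef)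
    (Sη : Matrix (Fin m₂) (Fin m₂) ℝ) (hSe : Sη.PosDef)
    (σY : ℝ) (hσY : 0 < σY)
    (σX : Fin K → ℝ) (hσX : ∀ k, 0 < σX k)
    (CX : Matrix ((k : Fin K) × Fin (n k)) (Fin m₁) ℝ)
    (CYα : Matrix (Fin N₂) (Fin m₁) ℝ)
    (CYη : Matrix (Fin N₂) (Fin m₂) ℝ)
    (μX : ((k : Fin K) × Fin (n k)) → ℝ) (μY : Fin N₂ → ℝ)
    (θ : Ω → (Fin m₁ ⊕ Fin m₂) → ℝ)
    (ε : Ω → (((k : Fin K) × Fin (n k)) ⊕ Fin N₂) → ℝ)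
    (hθm : Measurable θ) (hεm : Measurable ε)
    (hlawθ : P.map θ = mvGaussian 0 (Matrix.fromBlocks Sα 0 0 Sη))
    (hlawε : P.map ε = mvGaussian 0
      (Matrix.diagonal (Sum.elim (fun i => (σX i.1) ^ 2) (fun _ => σY ^ 2))))
    (hindep : P.map (fun ω => (θ ω, ε ω)) = (P.map θ).prod (P.map ε)) :
    ∃ κ : Kernel ((((k : Fin K) × Fin (n k)) ⊕ Fin N₂) → ℝ) ((Fin m₁ ⊕ Fin m₂) → ℝ),
      IsMarkovKernel κ
      ∧ P.map (fun ω =>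
            (Sum.elim μX μY
              + (Matrix.fromBlocks CX 0 CYα CYη) *ᵥ θ ω + ε ω, θ ω))
        = (P.map fun ω =>
            Sum.elim μX μY
              + (Matrix.fromBlocks CX 0 CYα CYη) *ᵥ θ ω + ε ω) ⊗ₘ κ
      ∧ ∀ᵐ w ∂(P.map fun ω =>
            Sum.elim μX μY
              + (Matrix.fromBlocks CX 0 CYα CYη) *ᵥ θ ω + ε ω),
          κ w = mvGaussian
            (((Matrix.fromBlocks Sα 0 0 Sη)⁻¹
                + ((Matrix.diagonal (Sum.elim (fun (i : (k : Fin K) × Fin (n k)) => σX i.1) (fun (_ : Fin N₂) => σY)))⁻¹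
                    * Matrix.fromBlocks CX 0 CYα CYη)ᵀ
                  * ((Matrix.diagonal (Sum.elim (fun (i : (k : Fin K) × Fin (n k)) => σX i.1) (fun (_ : Fin N₂) => σY)))⁻¹
                    * Matrix.fromBlocks CX 0 CYα CYη))⁻¹
              *ᵥ (((Matrix.diagonal (Sum.elim (fun (i : (k : Fin K) × Fin (n k)) => σX i.1) (fun (_ : Fin N₂) => σY)))⁻¹
                    * Matrix.fromBlocks CX 0 CYα CYη)ᵀ
                *ᵥ ((Matrix.diagonal (Sum.elim (fun (i : (k : Fin K) × Fin (n k)) => σX i.1) (fun (_ : Fin N₂) => σY)))⁻¹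
                  *ᵥ (w - Sum.elim μX μY))))
            (((Matrix.fromBlocks Sα 0 0 Sη)⁻¹
                + ((Matrix.diagonal (Sum.elim (fun (i : (k : Fin K) × Fin (n k)) => σX i.1) (fun (_ : Fin N₂) => σY)))⁻¹
                    * Matrix.fromBlocks CX 0 CYα CYη)ᵀ
                  * ((Matrix.diagonal (Sum.elim (fun (i : (k : Fin K) × Fin (n k)) => σX i.1) (fun (_ : Fin N₂) => σY)))⁻¹
                    * Matrix.fromBlocks CX 0 CYα CYη))⁻¹) := by
  obtain ⟨κ, h1, h2, h3⟩ := posterior_general P (Matrix.fromBlocks Sα 0 0 Sη) (pd_blocks hSa hSe)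
    (Sum.elim (fun (i : (k : Fin K) × Fin (n k)) => σX i.1) (fun (_ : Fin N₂) => σY))
    (by rintro (i | i); exacts [hσX _, hσY])
    (Matrix.fromBlocks CX 0 CYα CYη) (Sum.elim μX μY) θ ε hθm hεm hlawθ
    (by
      rw [hlawε]; congr 2; ext (i | i) <;> rfl) hindep
  exact ⟨κ, h1, h2, Filter.Eventually.of_forall h3⟩
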